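/- The minimum number of vertices of a simple graph whose set of vertex degrees is exactly {5, 6} and whose girth is 5 equals 31; that is, there exists a graph with degree set {5,6}, girth 5 and 31 vertices, and every graph with degree set {5,6} and girth 5 has at least 31 vertices. -/

import Mathlib

open SimpleGraph

/-- Degree of a vertex, as the cardinality of its neighbour set. -/
noncomputable def ndeg {V : Type} (G : SimpleGraph V) (v : V) : ℕ :=
  (G.neighborSet v).ncard

/-- The degree set of a graph: the set of degrees of its vertices. -/
def degreeSet' {V : Type} (G : SimpleGraph V) : Set ℕ :=
  {d | ∃ v, ndeg G v = d}

/-- The set of orders of finite graphs with degree set exactly `D` and girth `5`. -/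
def cageOrders (D : Set ℕ) : Set ℕ :=
  {n | ∃ (V : Type) (G : SimpleGraph V), Finite V ∧ Nat.card V = n ∧
        G.egirth = 5 ∧ degreeSet' G = D}

theorem ndeg_eq_card_neighborFinset {V : Type} (G : SimpleGraph V) (v : V)
    [Fintype (G.neighborSet v)] : ndeg G v = (G.neighborFinset v).card :=
  Set.ncard_eq_toFinset_card' _

/-- A graph without triangles and 4-cycles has girth at least `5`. -/
theorem five_le_egirth {V : Type} {G : SimpleGraph V}
    (h3 : ∀ a b c, G.Adj a b → G.Adj b c → ¬ G.Adj c a)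
    (h4 : ∀ a b c d, G.Adj a b → G.Adj b c → G.Adj c d → a ≠ c → b ≠ d → ¬ G.Adj d a) :
    5 ≤ G.egirth := by
  rw [le_egirth]
  intro a w hw
  have hlen : w.length ≠ 3 ∧ w.length ≠ 4 := by
    constructor
    · intro hl
      match w, hw, hl with
      | .cons h₁ (.cons h₂ (.cons h₃ .nil)), _, _ => exact h3 _ _ _ h₁ h₂ h₃
    · intro hl
      match w, hw, hl with
      | .cons h₁ (.cons h₂ (.cons h₃ (.cons h₄ .nil))), hw, _ =>
        have hnd := hw.support_nodup
        simp at hnd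
        exact h4 _ _ _ _ h₁ h₂ h₃ (by tauto) (by tauto) h₄
  have := hw.three_le_length
  exact_mod_cast (by omega : 5 ≤ w.length)

/-- A graph of girth at least `5` has no triangles. -/
theorem not_adj_of_five_le_egirth {V : Type} {G : SimpleGraph V} (hG : 5 ≤ G.egirth)
    {a b c : V} (hab : G.Adj a b) (hbc : G.Adj b c) : ¬ G.Adj c a := by
  intro hca
  have hcyc : (Walk.cons hab (.cons hbc (.cons hca .nil))).IsCycle := by
    simp [Walk.cons_isCycle_iff, hab.ne, hbc.ne, hca.ne, hab.ne', hca.ne']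
  have h := le_egirth.1 hG _ _ hcyc
  simp only [Walk.length_cons, Walk.length_nil] at h
  exact absurd h (by decide)

/-- In a graph of girth at least `5` distinct vertices have at most one common neighbour. -/
theorem eq_of_five_le_egirth {V : Type} {G : SimpleGraph V} (hG : 5 ≤ G.egirth)
    {a b c d : V} (hab : G.Adj a b) (hbc : G.Adj b c) (hcd : G.Adj c d) (hda : G.Adj d a)
    (hac : a ≠ c) : b = d := by
  by_contra hbd
  have hcyc : (Walk.cons hab (.cons hbc (.cons hcd (.cons hda .nil)))).IsCycle := by
    simp [Walk.cons_isCycle_iff, hab.ne, hbc.ne, hcd.ne, hda.ne, hab.ne',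
      hda.ne', hac, hac.symm, hbd]
  have h := le_egirth.1 hG _ _ hcyc
  simp only [Walk.length_cons, Walk.length_nil] at h
  exact absurd h (by decide)

/-- The Moore bound for girth `5`: count the vertices at distance at most `2` from `v`. -/
theorem moore_bound_of_five_le_egirth {V : Type} [Finite V] {G : SimpleGraph V}
    (hG : 5 ≤ G.egirth) {k : ℕ} (hk : ∀ u, k + 1 ≤ ndeg G u) (v : V) :
    1 + ndeg G v * (k + 1) ≤ Nat.card V := by
  classical
  have := Fintype.ofFinite V
  have hdeg : ∀ u, ndeg G u = (G.neighborFinset u).card := fun u =>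
    ndeg_eq_card_neighborFinset G u
  let B : V → Finset V := fun u => insert u ((G.neighborFinset u).erase v)
  have hB : ∀ u ∈ G.neighborFinset v, k + 1 ≤ (B u).card := by
    intro u hu
    rw [mem_neighborFinset] at hu
    rw [Finset.card_insert_of_notMem (by simp), Finset.card_erase_of_mem (by simpa using hu.symm),
      ← hdeg]
    have := hk u
    omega
  have hdisj : Set.PairwiseDisjoint (G.neighborFinset v : Set V) B := by
    intro u hu w hw huw
    simp only [coe_neighborFinset, mem_neighborSet] at hu hw
    refine Finset.disjoint_left.2 fun x hxu hxw => ?_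
    simp only [B, Finset.mem_insert, Finset.mem_erase, mem_neighborFinset] at hxu hxw
    rcases hxu with rfl | ⟨hxv, hux⟩ <;> rcases hxw with rfl | ⟨hxv', hwx⟩
    · exact huw rfl
    · exact not_adj_of_five_le_egirth hG hw hwx hu.symm
    · exact not_adj_of_five_le_egirth hG hu hux hw.symm
    · exact huw (eq_of_five_le_egirth hG hu hux hwx.symm hw.symm (Ne.symm hxv))
  have hv : v ∉ (G.neighborFinset v).biUnion B := by
    simp only [B, Finset.mem_biUnion, Finset.mem_insert, Finset.mem_erase, mem_neighborFinset]
    rintro ⟨u, hu, rfl | h⟩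
    · exact G.loopless.irrefl _ hu
    · exact h.1 rfl
  calc 1 + ndeg G v * (k + 1)
      ≤ 1 + ∑ u ∈ G.neighborFinset v, (B u).card := by
        rw [hdeg, ← smul_eq_mul]
        exact Nat.add_le_add_left (Finset.card_nsmul_le_sum _ _ _ hB) 1
    _ = (insert v ((G.neighborFinset v).biUnion B)).card := by
        rw [Finset.card_insert_of_notMem hv, Finset.card_biUnion hdisj, add_comm]
    _ ≤ Nat.card V := by
        rw [Nat.card_eq_fintype_card]
        exact Finset.card_le_univ _

/-- A root, its six children, and four grandchildren below each child. -/
abbrev TreeVertex : Type := Option (Fin 6 × Option (Fin 4))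

/-- Voltages in `ℤ/4` on the arcs of the octahedron whose antipodal pairs are `{g, 5 - g}`. -/
def voltage : Fin 6 → Fin 6 → Fin 4 :=
  ![![0, 0, 3, 1, 2, 0], ![0, 0, 1, 2, 0, 3], ![1, 3, 0, 0, 2, 3],
    ![3, 2, 0, 0, 3, 3], ![2, 0, 2, 1, 0, 3], ![0, 1, 1, 1, 1, 0]]

/-- Adjacency of the tree together with the voltage lift of the octahedron on its leaves. -/
def liftAdj : TreeVertex → TreeVertex → Bool
  | none, some (_, none) => true
  | some (_, none), none => true
  | some (g, none), some (h, some _) => g == h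
  | some (g, some _), some (h, none) => g == h
  | some (g, some i), some (h, some j) => g != h && g != h.rev && j == i + voltage g h
  | _, _ => false

/-- A graph of girth `5` on `31` vertices, whose root has degree `6` and all of whose other
vertices have degree `5`. -/
def liftGraph : SimpleGraph TreeVertex where
  Adj a b := liftAdj a b = true
  symm := ⟨by decide +kernel⟩
  loopless := ⟨by decide +kernel⟩

instance : DecidableRel liftGraph.Adj := fun a b =>
  inferInstanceAs (Decidable (liftAdj a b = true))

theorem egirth_liftGraph : liftGraph.egirth = 5 := by
  apply le_antisymm
  · have h₁ : liftGraph.Adj none (some (0, none)) := by decide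
    have h₂ : liftGraph.Adj (some (0, none)) (some (0, some 0)) := by decide
    have h₃ : liftGraph.Adj (some (0, some 0)) (some (1, some 0)) := by decide
    have h₄ : liftGraph.Adj (some (1, some 0)) (some (1, none)) := by decide
    have h₅ : liftGraph.Adj (some (1, none)) none := by decide
    have hcyc : (Walk.cons h₁ (.cons h₂ (.cons h₃ (.cons h₄ (.cons h₅ .nil))))).IsCycle := by
      simp [Walk.cons_isCycle_iff]
    exact egirth_le_length hcyc
  · apply five_le_egirth
    · have h : ∀ a b, liftGraph.Adj a b → ∀ c, liftGraph.Adj b c → ¬ liftGraph.Adj c a := by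
        decide +kernel
      exact fun a b c hab => h a b hab c
    · have h : ∀ a b, liftGraph.Adj a b → ∀ c, liftGraph.Adj b c → a ≠ c →
          ∀ d, liftGraph.Adj c d → b ≠ d → ¬ liftGraph.Adj d a := by
        decide +kernel
      exact fun a b c d hab hbc hcd hac => h a b hab c hbc hac d hcd

theorem ndeg_liftGraph (v : TreeVertex) : ndeg liftGraph v = if v = none then 6 else 5 := by
  have h : ∀ v, (liftGraph.neighborFinset v).card = if v = none then 6 else 5 := by
    decide +kernel
  rw [ndeg_eq_card_neighborFinset, h]

theorem degreeSet'_liftGraph : degreeSet' liftGraph = {5, 6} := by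
  ext d
  simp only [degreeSet', ndeg_liftGraph, Set.mem_ofPred_eq, Set.mem_insert_iff,
    Set.mem_singleton_iff]
  constructor
  · rintro ⟨v, rfl⟩
    split_ifs <;> simp
  · rintro (rfl | rfl)
    · exact ⟨some (0, none), by simp⟩
    · exact ⟨none, by simp⟩

/-- the minimum order of a graph with degree set exactly {5,6} and girth 5
equals 31. -/
theorem stmt17 : IsLeast (cageOrders {5, 6}) 31 := by
  constructor
  · exact ⟨TreeVertex, liftGraph, inferInstance, by simp, egirth_liftGraph,
      degreeSet'_liftGraph⟩
  · rintro n ⟨V, G, hV, rfl, hg, hD⟩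
    obtain ⟨v, hv⟩ : 6 ∈ degreeSet' G := by simp [hD]
    have hmin : ∀ u, 4 + 1 ≤ ndeg G u := by
      intro u
      have hu : ndeg G u ∈ degreeSet' G := ⟨u, rfl⟩
      rw [hD, Set.mem_insert_iff, Set.mem_singleton_iff] at hu
      omega
    have := moore_bound_of_five_le_egirth hg.ge hmin v
    omega
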